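/- (Theorem 3.1) Let ρ be a pure quadripartite qudit state on ℂ^d ⊗ ℂ^d ⊗ ℂ^d ⊗ ℂ^d. Then the six isotropic strengths satisfy the trade-off relation s_iso^{AB} + s_iso^{AC} + s_iso^{AD} + s_iso^{BC} + s_iso^{CD} + s_iso^{BD} = ((−d²+3)(d²−1) + (d²−2)(‖a‖²+‖b‖²+‖c‖²+‖d‖²) + ‖R^{ABCD}‖²)/(d²−1). -/

import Mathlib

open Matrix ComplexOrder

namespace SpinCorr4

variable {d : ℕ}

/-- Tensor (Kronecker) product of four `d × d` matrices, acting on `(ℂ^d)^{⊗4}`. -/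
noncomputable def kron4 (A B C D : Matrix (Fin d) (Fin d) ℂ) :
    Matrix (Fin d × Fin d × Fin d × Fin d) (Fin d × Fin d × Fin d × Fin d) ℂ :=
  Matrix.of fun p q =>
    A p.1 q.1 * B p.2.1 q.2.1 * C p.2.2.1 q.2.2.1 * D p.2.2.2 q.2.2.2

variable (lam : Fin (d ^ 2 - 1) → Matrix (Fin d) (Fin d) ℂ)
variable (ρ : Matrix (Fin d × Fin d × Fin d × Fin d) (Fin d × Fin d × Fin d × Fin d) ℂ)

/-- `‖a‖²`, the squared Euclidean norm of the Bloch vector of party A. -/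
noncomputable def aSq : ℝ := ∑ i, ‖(ρ * kron4 (lam i) 1 1 1).trace‖ ^ 2

/-- `‖b‖²`. -/
noncomputable def bSq : ℝ := ∑ i, ‖(ρ * kron4 1 (lam i) 1 1).trace‖ ^ 2

/-- `‖c‖²`. -/
noncomputable def cSq : ℝ := ∑ i, ‖(ρ * kron4 1 1 (lam i) 1).trace‖ ^ 2

/-- `‖d‖²`. -/
noncomputable def dSq : ℝ := ∑ i, ‖(ρ * kron4 1 1 1 (lam i)).trace‖ ^ 2

/-- `‖R^{AB}‖²`, squared Frobenius norm of the spin correlation matrix of parties A,B. -/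
noncomputable def RABsq : ℝ := ∑ i, ∑ j, ‖(ρ * kron4 (lam i) (lam j) 1 1).trace‖ ^ 2

/-- `‖R^{AC}‖²`. -/
noncomputable def RACsq : ℝ := ∑ i, ∑ j, ‖(ρ * kron4 (lam i) 1 (lam j) 1).trace‖ ^ 2

/-- `‖R^{AD}‖²`. -/
noncomputable def RADsq : ℝ := ∑ i, ∑ j, ‖(ρ * kron4 (lam i) 1 1 (lam j)).trace‖ ^ 2

/-- `‖R^{BC}‖²`. -/
noncomputable def RBCsq : ℝ := ∑ i, ∑ j, ‖(ρ * kron4 1 (lam i) (lam j) 1).trace‖ ^ 2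

/-- `‖R^{BD}‖²`. -/
noncomputable def RBDsq : ℝ := ∑ i, ∑ j, ‖(ρ * kron4 1 (lam i) 1 (lam j)).trace‖ ^ 2

/-- `‖R^{CD}‖²`. -/
noncomputable def RCDsq : ℝ := ∑ i, ∑ j, ‖(ρ * kron4 1 1 (lam i) (lam j)).trace‖ ^ 2

/-- `‖R^{ABC}‖²`, squared Euclidean norm of the three-body correlation tensor of A,B,C. -/
noncomputable def RABCsq : ℝ :=
  ∑ i, ∑ j, ∑ l, ‖(ρ * kron4 (lam i) (lam j) (lam l) 1).trace‖ ^ 2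

/-- `‖R^{ABD}‖²`. -/
noncomputable def RABDsq : ℝ :=
  ∑ i, ∑ j, ∑ l, ‖(ρ * kron4 (lam i) (lam j) 1 (lam l)).trace‖ ^ 2

/-- `‖R^{ACD}‖²`. -/
noncomputable def RACDsq : ℝ :=
  ∑ i, ∑ j, ∑ l, ‖(ρ * kron4 (lam i) 1 (lam j) (lam l)).trace‖ ^ 2

/-- `‖R^{BCD}‖²`. -/
noncomputable def RBCDsq : ℝ :=
  ∑ i, ∑ j, ∑ l, ‖(ρ * kron4 1 (lam i) (lam j) (lam l)).trace‖ ^ 2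

/-- `‖R^{ABCD}‖²`, squared Euclidean norm of the four-body correlation tensor. -/
noncomputable def RABCDsq : ℝ :=
  ∑ i, ∑ j, ∑ l, ∑ m, ‖(ρ * kron4 (lam i) (lam j) (lam l) (lam m)).trace‖ ^ 2

/-- Isotropic strength `s_iso^{AB} = ‖R^{AB}‖²/(d²-1)`. -/
noncomputable def sAB : ℝ := RABsq lam ρ / ((d : ℝ) ^ 2 - 1)

/-- `s_iso^{AC}`. -/
noncomputable def sAC : ℝ := RACsq lam ρ / ((d : ℝ) ^ 2 - 1)

/-- `s_iso^{AD}`. -/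
noncomputable def sAD : ℝ := RADsq lam ρ / ((d : ℝ) ^ 2 - 1)

/-- `s_iso^{BC}`. -/
noncomputable def sBC : ℝ := RBCsq lam ρ / ((d : ℝ) ^ 2 - 1)

/-- `s_iso^{BD}`. -/
noncomputable def sBD : ℝ := RBDsq lam ρ / ((d : ℝ) ^ 2 - 1)

/-- `s_iso^{CD}`. -/
noncomputable def sCD : ℝ := RCDsq lam ρ / ((d : ℝ) ^ 2 - 1)

/-- A family of matrices whose second moment `∑ k, M k ⊗ M k` is `c` times the swap operator. -/
def IsSwapFamily {κ X : Type*} [Fintype κ] [DecidableEq X] (c : ℂ) (M : κ → Matrix X X ℂ) : Prop :=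
  ∀ p q r s, ∑ k, M k p q * M k r s = if p = s ∧ q = r then c else 0

theorem IsSwapFamily.kronecker {κ ι X Y : Type*} [Fintype κ] [Fintype ι] [DecidableEq X]
    [DecidableEq Y] {c c' : ℂ} {M : κ → Matrix X X ℂ} {N : ι → Matrix Y Y ℂ}
    (hM : IsSwapFamily c M) (hN : IsSwapFamily c' N) :
    IsSwapFamily (c * c') fun k : κ × ι => kroneckerMap (· * ·) (M k.1) (N k.2) := by
  rintro ⟨p, p'⟩ ⟨q, q'⟩ ⟨r, r'⟩ ⟨s, s'⟩
  have h : ∀ k : κ × ι, M k.1 p q * N k.2 p' q' * (M k.1 r s * N k.2 r' s') =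
      (M k.1 p q * M k.1 r s) * (N k.2 p' q' * N k.2 r' s') := fun k => by ring
  simp only [kroneckerMap_apply, h, Fintype.sum_prod_type, ← Finset.mul_sum, ← Finset.sum_mul,
    hM p q r s, hN p' q' r' s', Prod.mk.injEq]
  split_ifs <;> simp_all

theorem IsSwapFamily.sum_trace_sq {κ X : Type*} [Fintype κ] [Fintype X] [DecidableEq X] {c : ℂ}
    {M : κ → Matrix X X ℂ} (hM : IsSwapFamily c M) (σ : Matrix X X ℂ) :
    ∑ k, (σ * M k).trace ^ 2 = c * (σ * σ).trace := by
  have h : ∀ k, (σ * M k).trace ^ 2 =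
      ∑ x : X × X, ∑ y : X × X, σ x.1 x.2 * σ y.1 y.2 * (M k x.2 x.1 * M k y.2 y.1) := by
    intro k
    simp only [trace, diag, mul_apply, sq, ← Fintype.sum_prod_type', Finset.sum_mul_sum]
    exact Finset.sum_congr rfl fun x _ => by ring
  simp only [h]
  rw [Finset.sum_comm]
  simp only [Finset.sum_comm (s := (Finset.univ : Finset κ)), ← Finset.mul_sum, hM _ _ _ _]
  simp only [trace, diag, mul_apply, Finset.mul_sum, Fintype.sum_prod_type]
  refine Finset.sum_congr rfl fun x _ => Finset.sum_congr rfl fun y _ => ?_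
  rw [Finset.sum_eq_single y, Finset.sum_eq_single x]
  · simp [mul_comm]
  · intro z _ hz
    simp [Ne.symm hz]
  · simp
  · intro z _ hz
    simp [Ne.symm hz]
  · simp

/-- All `2 × 2` minors vanish. -/
def MinorsVanish {X : Type*} (σ : Matrix X X ℂ) : Prop :=
  ∀ p q r s, σ p q * σ r s = σ p s * σ r q

theorem minorsVanish_of_isHermitian_of_idempotent {X : Type*} [Fintype X] [DecidableEq X]
    {σ : Matrix X X ℂ} (hσ : σ.IsHermitian) (htr : σ.trace = 1) (hid : σ * σ = σ) :
    MinorsVanish σ := by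
  have hc : ∀ p q, star (σ p q) = σ q p := fun p q => hσ.apply q p
  have hm : ∀ p q, ∑ x, σ p x * σ x q = σ p q := fun p q => by
    rw [← mul_apply, hid]
  have ht : ∑ x, σ x x = 1 := htr
  have key : ∑ p, ∑ q, ∑ r, ∑ s, (σ p q * σ r s - σ p s * σ r q) *
      star (σ p q * σ r s - σ p s * σ r q) = 0 := by
    have e : ∀ p q r s, (σ p q * σ r s - σ p s * σ r q) *
        star (σ p q * σ r s - σ p s * σ r q) =
        (σ p q * σ q p) * (σ r s * σ s r) - (σ p q * σ q r) * (σ r s * σ s p)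
          - (σ r q * σ q p) * (σ p s * σ s r) + (σ r q * σ q r) * (σ p s * σ s p) := by
      intro p q r s
      simp only [star_sub, star_mul, hc]
      ring
    simp only [e, Finset.sum_add_distrib, Finset.sum_sub_distrib, ← Finset.mul_sum, hm]
    have f : ∀ g : X → X → X → ℂ, ∑ p, ∑ q, ∑ r, g p q r = ∑ p, ∑ r, ∑ q, g p q r :=
      fun g => Finset.sum_congr rfl fun p _ => Finset.sum_comm
    simp only [f, ← Finset.sum_mul, hm]
    simp only [← Finset.mul_sum, ht]
    ring
  have nn : ∀ z : ℂ, 0 ≤ z * star z := fun z => mul_star_self_nonneg z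
  intro p q r s
  have h1 := (Finset.sum_eq_zero_iff_of_nonneg fun p _ => Finset.sum_nonneg fun q _ =>
    Finset.sum_nonneg fun r _ => Finset.sum_nonneg fun s _ => nn _).1 key p (Finset.mem_univ p)
  have h2 := (Finset.sum_eq_zero_iff_of_nonneg fun q _ =>
    Finset.sum_nonneg fun r _ => Finset.sum_nonneg fun s _ => nn _).1 h1 q (Finset.mem_univ q)
  have h3 := (Finset.sum_eq_zero_iff_of_nonneg fun r _ =>
    Finset.sum_nonneg fun s _ => nn _).1 h2 r (Finset.mem_univ r)
  have h4 := (Finset.sum_eq_zero_iff_of_nonneg fun s _ => nn _).1 h3 s (Finset.mem_univ s)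
  rcases mul_eq_zero.1 h4 with h | h
  · exact sub_eq_zero.1 h
  · exact sub_eq_zero.1 (star_eq_zero.1 h)

/-- The two reduced matrices of a rank-one bipartite matrix have the same purity. -/
theorem IsSwapFamily.sum_trace_kronecker_one_sq {κ ι X Y : Type*} [Fintype κ] [Fintype ι]
    [Fintype X] [Fintype Y] [DecidableEq X] [DecidableEq Y] {c c' : ℂ}
    {M : κ → Matrix X X ℂ} {N : ι → Matrix Y Y ℂ}
    (hM : IsSwapFamily c M) (hN : IsSwapFamily c' N)
    {σ : Matrix (X × Y) (X × Y) ℂ} (hσ : MinorsVanish σ) :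
    c' * ∑ k, (σ * kroneckerMap (· * ·) (M k) (1 : Matrix Y Y ℂ)).trace ^ 2 =
      c * ∑ l, (σ * kroneckerMap (· * ·) (1 : Matrix X X ℂ) (N l)).trace ^ 2 := by
  have hX : ∀ A : Matrix X X ℂ, (σ * kroneckerMap (· * ·) A (1 : Matrix Y Y ℂ)).trace =
      ((of fun p q => ∑ y, σ (p, y) (q, y) : Matrix X X ℂ) * A).trace := by
    intro A
    simp only [trace, diag, mul_apply, Fintype.sum_prod_type, kroneckerMap_apply, one_apply,
      of_apply, mul_ite, mul_one, mul_zero, Finset.sum_ite_eq', Finset.mem_univ, if_true,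
      Finset.sum_mul]
    exact Finset.sum_congr rfl fun p _ => Finset.sum_comm
  have hY : ∀ A : Matrix Y Y ℂ, (σ * kroneckerMap (· * ·) (1 : Matrix X X ℂ) A).trace =
      ((of fun p q => ∑ x, σ (x, p) (x, q) : Matrix Y Y ℂ) * A).trace := by
    intro A
    simp only [trace, diag, mul_apply, Fintype.sum_prod_type_right, kroneckerMap_apply, one_apply,
      of_apply, ite_mul, one_mul, zero_mul, mul_ite, mul_zero, Finset.sum_ite_eq',
      Finset.mem_univ, if_true, Finset.sum_mul]
    exact Finset.sum_congr rfl fun p _ => Finset.sum_comm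
  simp only [hX, hY, hM.sum_trace_sq, hN.sum_trace_sq]
  have h : ((of fun p q => ∑ y, σ (p, y) (q, y) : Matrix X X ℂ) *
      (of fun p q => ∑ y, σ (p, y) (q, y) : Matrix X X ℂ)).trace =
      ((of fun p q => ∑ x, σ (x, p) (x, q) : Matrix Y Y ℂ) *
      (of fun p q => ∑ x, σ (x, p) (x, q) : Matrix Y Y ℂ)).trace := by
    simp only [trace, diag, mul_apply, of_apply, Finset.sum_mul_sum, ← Fintype.sum_prod_type']
    let e : X × X × Y × Y ≃ Y × Y × X × X :=
      ⟨fun t => (t.2.2.1, t.2.2.2, t.1, t.2.1), fun t => (t.2.2.1, t.2.2.2, t.1, t.2.1),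
        fun _ => rfl, fun _ => rfl⟩
    refine Fintype.sum_equiv e _ _ fun t => ?_
    exact hσ _ _ _ _
  rw [h]
  ring

/-- The identity adjoined to a family of matrices. -/
noncomputable def withOne (lam : Fin (d ^ 2 - 1) → Matrix (Fin d) (Fin d) ℂ) :
    Option (Fin (d ^ 2 - 1)) → Matrix (Fin d) (Fin d) ℂ :=
  fun o => o.elim 1 lam

theorem isSwapFamily_withOne (hd : 1 ≤ d) {lam : Fin (d ^ 2 - 1) → Matrix (Fin d) (Fin d) ℂ}
    (htr0 : ∀ i, (lam i).trace = 0)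
    (horth : ∀ i j, (lam i * lam j).trace = if i = j then (d : ℂ) else 0) :
    IsSwapFamily (d : ℂ) (withOne lam) := by
  have hd0 : (d : ℂ) ≠ 0 := by exact_mod_cast (by omega : d ≠ 0)
  have ho : ∀ a b, (withOne lam a * withOne lam b).trace = if a = b then (d : ℂ) else 0 := by
    rintro (_ | i) (_ | j) <;> simp [withOne, htr0, horth]
  let U : Matrix (Option (Fin (d ^ 2 - 1))) (Fin d × Fin d) ℂ :=
    of fun a x => withOne lam a x.1 x.2
  let V : Matrix (Fin d × Fin d) (Option (Fin (d ^ 2 - 1))) ℂ :=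
    of fun x a => (d : ℂ)⁻¹ * withOne lam a x.2 x.1
  have hUV : U * V = 1 := by
    ext a b
    have h := ho a b
    simp only [trace, diag, mul_apply, ← Fintype.sum_prod_type'] at h
    simp only [U, V, mul_apply, of_apply, mul_left_comm _ (d : ℂ)⁻¹, ← Finset.mul_sum, h,
      one_apply]
    split_ifs <;> simp [hd0]
  have hcard : Fintype.card (Option (Fin (d ^ 2 - 1))) = Fintype.card (Fin d × Fin d) := by
    have : 1 ≤ d ^ 2 := Nat.one_le_pow _ _ hd
    simp only [Fintype.card_option, Fintype.card_fin, Fintype.card_prod, ← sq]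
    omega
  have hVU : V * U = 1 := (mul_eq_one_comm_of_card_eq _ _ _ hcard).1 hUV
  intro p q r s
  have h := congrFun₂ hVU (q, p) (r, s)
  simp only [U, V, mul_apply, of_apply, mul_assoc, ← Finset.mul_sum, one_apply,
    Prod.mk.injEq] at h
  rw [inv_mul_eq_iff_eq_mul₀ hd0] at h
  rw [h]
  split_ifs <;> simp_all

theorem kron4_eq (A B C D : Matrix (Fin d) (Fin d) ℂ) :
    kron4 A B C D =
      kroneckerMap (· * ·) A (kroneckerMap (· * ·) B (kroneckerMap (· * ·) C D)) := by
  ext p q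
  simp [kron4, mul_assoc]

theorem kron4_isHermitian {A B C D : Matrix (Fin d) (Fin d) ℂ} (hA : A.IsHermitian)
    (hB : B.IsHermitian) (hC : C.IsHermitian) (hD : D.IsHermitian) :
    (kron4 A B C D).IsHermitian := by
  ext p q
  simp only [kron4, conjTranspose_apply, of_apply, star_mul', hA.apply, hB.apply, hC.apply,
    hD.apply]

theorem ofReal_norm_trace_mul_sq {X : Type*} [Fintype X] {σ M : Matrix X X ℂ}
    (hσ : σ.IsHermitian) (hM : M.IsHermitian) :
    ((‖(σ * M).trace‖ ^ 2 : ℝ) : ℂ) = (σ * M).trace ^ 2 := by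
  have h : star (σ * M).trace = (σ * M).trace := by
    rw [← trace_conjTranspose, conjTranspose_mul, hσ.eq, hM.eq, trace_mul_comm]
  rw [Complex.ofReal_pow, ← Complex.mul_conj', ← Complex.star_def, h, sq]

/-- The purity identity between one party and the other three. -/
theorem one_three_purity {lam : Fin (d ^ 2 - 1) → Matrix (Fin d) (Fin d) ℂ} (hd : 1 ≤ d)
    (hW : IsSwapFamily (d : ℂ) (withOne lam))
    {ρ : Matrix (Fin d × Fin d × Fin d × Fin d) (Fin d × Fin d × Fin d × Fin d) ℂ}
    (hρ : MinorsVanish ρ) :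
    (d : ℂ) ^ 2 * ∑ i, (ρ * kron4 (withOne lam i) 1 1 1).trace ^ 2 =
      ∑ i, ∑ j, ∑ k,
        (ρ * kron4 1 (withOne lam i) (withOne lam j) (withOne lam k)).trace ^ 2 := by
  have hd0 : (d : ℂ) ≠ 0 := by exact_mod_cast (by omega : d ≠ 0)
  have h := hW.sum_trace_kronecker_one_sq (hW.kronecker (hW.kronecker hW)) hρ
  have h1 : kroneckerMap (· * ·) (1 : Matrix (Fin d) (Fin d) ℂ)
      (kroneckerMap (· * ·) (1 : Matrix (Fin d) (Fin d) ℂ) (1 : Matrix (Fin d) (Fin d) ℂ)) = 1 := by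
    rw [kroneckerMap_one_one _ zero_mul mul_zero (mul_one 1),
      kroneckerMap_one_one _ zero_mul mul_zero (mul_one 1)]
  simp only [Fintype.sum_prod_type] at h
  simp only [kron4_eq, h1]
  apply mul_left_cancel₀ hd0
  rw [← h]
  ring

theorem trace_submatrix_mul {X Y : Type*} [Fintype X] [Fintype Y] (e : Y ≃ X)
    (σ : Matrix X X ℂ) (M : Matrix Y Y ℂ) :
    (σ.submatrix e e * M).trace = (σ * M.submatrix e.symm e.symm).trace := by
  simp only [trace, diag, mul_apply, submatrix_apply]
  refine Fintype.sum_equiv e _ _ fun x => Fintype.sum_equiv e _ _ fun y => ?_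
  simp

/-- Theorem 3.1: trade-off relation for the six isotropic strengths of a pure
quadripartite qudit state. -/
theorem isotropic_strength_tradeoff_pure_quadripartite (d : ℕ) (hd : 2 ≤ d)
    (lam : Fin (d ^ 2 - 1) → Matrix (Fin d) (Fin d) ℂ)
    (hherm : ∀ i, (lam i).IsHermitian)
    (htr0 : ∀ i, (lam i).trace = 0)
    (horth : ∀ i j, (lam i * lam j).trace = if i = j then (d : ℂ) else 0)
    (ρ : Matrix (Fin d × Fin d × Fin d × Fin d) (Fin d × Fin d × Fin d × Fin d) ℂ)
    (hpsd : ρ.PosSemidef) (htr1 : ρ.trace = 1) (hpure : ρ * ρ = ρ) :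
    sAB lam ρ + sAC lam ρ + sAD lam ρ + sBC lam ρ + sCD lam ρ + sBD lam ρ =
      ((-(d : ℝ) ^ 2 + 3) * ((d : ℝ) ^ 2 - 1) +
        ((d : ℝ) ^ 2 - 2) * (aSq lam ρ + bSq lam ρ + cSq lam ρ + dSq lam ρ) +
        RABCDsq lam ρ) / ((d : ℝ) ^ 2 - 1) := by
  have hd1 : 1 ≤ d := by omega
  have hρ := minorsVanish_of_isHermitian_of_idempotent hpsd.1 htr1 hpure
  have hW := isSwapFamily_withOne hd1 htr0 horth
  have hT := (hW.kronecker (hW.kronecker (hW.kronecker hW))).sum_trace_sq ρ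
  rw [hpure, htr1] at hT
  simp only [← kron4_eq, Fintype.sum_prod_type] at hT
  let eB : Fin d × Fin d × Fin d × Fin d ≃ Fin d × Fin d × Fin d × Fin d :=
    ⟨fun p => (p.2.1, p.1, p.2.2.1, p.2.2.2), fun p => (p.2.1, p.1, p.2.2.1, p.2.2.2),
      fun _ => rfl, fun _ => rfl⟩
  let eC : Fin d × Fin d × Fin d × Fin d ≃ Fin d × Fin d × Fin d × Fin d :=
    ⟨fun p => (p.2.1, p.2.2.1, p.1, p.2.2.2), fun p => (p.2.2.1, p.1, p.2.1, p.2.2.2),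
      fun _ => rfl, fun _ => rfl⟩
  let eD : Fin d × Fin d × Fin d × Fin d ≃ Fin d × Fin d × Fin d × Fin d :=
    ⟨fun p => (p.2.1, p.2.2.1, p.2.2.2, p.1), fun p => (p.2.2.2, p.1, p.2.1, p.2.2.1),
      fun _ => rfl, fun _ => rfl⟩
  have hkB : ∀ A B C D : Matrix (Fin d) (Fin d) ℂ,
      (kron4 A B C D).submatrix eB.symm eB.symm = kron4 B A C D := fun A B C D => by
    ext p q
    simp only [kron4, submatrix_apply, of_apply, eB, Equiv.coe_fn_symm_mk]
    ring
  have hkC : ∀ A B C D : Matrix (Fin d) (Fin d) ℂ,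
      (kron4 A B C D).submatrix eC.symm eC.symm = kron4 B C A D := fun A B C D => by
    ext p q
    simp only [kron4, submatrix_apply, of_apply, eC, Equiv.coe_fn_symm_mk]
    ring
  have hkD : ∀ A B C D : Matrix (Fin d) (Fin d) ℂ,
      (kron4 A B C D).submatrix eD.symm eD.symm = kron4 B C D A := fun A B C D => by
    ext p q
    simp only [kron4, submatrix_apply, of_apply, eD, Equiv.coe_fn_symm_mk]
    ring
  have hA := one_three_purity hd1 hW hρ
  have hB := one_three_purity hd1 hW (ρ := ρ.submatrix eB eB) fun _ _ _ _ => hρ _ _ _ _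
  have hC := one_three_purity hd1 hW (ρ := ρ.submatrix eC eC) fun _ _ _ _ => hρ _ _ _ _
  have hD := one_three_purity hd1 hW (ρ := ρ.submatrix eD eD) fun _ _ _ _ => hρ _ _ _ _
  simp only [trace_submatrix_mul, hkB] at hB
  simp only [trace_submatrix_mul, hkC] at hC
  simp only [trace_submatrix_mul, hkD] at hD
  have hnone : withOne lam none = 1 := rfl
  have hsome : ∀ i, withOne lam (some i) = lam i := fun _ => rfl
  have hone : (ρ * kron4 (1 : Matrix (Fin d) (Fin d) ℂ) 1 1 1).trace = 1 := by
    have h1 : kron4 (1 : Matrix (Fin d) (Fin d) ℂ) 1 1 1 = 1 := by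
      simp only [kron4_eq, kroneckerMap_one_one _ zero_mul mul_zero (mul_one (1 : ℂ))]
    rw [h1, mul_one, htr1]
  simp only [Fintype.sum_option, Finset.sum_add_distrib, hnone, hsome, hone, one_pow]
    at hA hB hC hD hT
  have cast : ∀ {A B C D : Matrix (Fin d) (Fin d) ℂ}, A.IsHermitian → B.IsHermitian →
      C.IsHermitian → D.IsHermitian →
      ((‖(ρ * kron4 A B C D).trace‖ : ℂ)) ^ 2 = (ρ * kron4 A B C D).trace ^ 2 :=
    fun hA hB hC hD => by
      rw [← ofReal_norm_trace_mul_sq hpsd.1 (kron4_isHermitian hA hB hC hD), Complex.ofReal_pow]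
  simp only [sAB, sAC, sAD, sBC, sBD, sCD, ← add_div]
  congr 1
  apply Complex.ofReal_injective
  simp only [aSq, bSq, cSq, dSq, RABsq, RACsq, RADsq, RBCsq, RBDsq, RCDsq, RABCDsq]
  push_cast
  simp only [cast, hherm, isHermitian_one]
  linear_combination -hT - hA - hB - hC - hD


end SpinCorr4
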